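/- Let x₀,…,x₇ be real numbers and let Mₓ be the real 8×8 matrix with rows (x₀, −x₁, −x₂, −x₃, −x₄, −x₅, −x₆, x₇), (x₁, x₀, −x₃, x₂, x₅, −x₄, −x₇, −x₆), (x₂, x₃, x₀, −x₁, −x₆, −x₇, x₄, −x₅), (x₃, −x₂, x₁, x₀, −x₇, x₆, −x₅, −x₄), (x₄, −x₅, x₆, −x₇, x₀, x₁, −x₂, −x₃), (x₅, x₄, −x₇, −x₆, −x₁, x₀, x₃, −x₂), (x₆, −x₇, −x₄, x₅, x₂, −x₃, x₀, −x₁), (x₇, x₆, x₅, x₄, x₃, x₂, x₁, x₀). Then det(Mₓ) = Q₁(x)² · Q₂(x)², where Q₁(x) = Σᵢ xᵢ² − 2(x₁x₆+x₂x₅+x₃x₄) + 2x₀x₇ and Q₂(x) = Σᵢ xᵢ² + 2(x₁x₆+x₂x₅+x₃x₄) − 2x₀x₇. In particular Mₓ is invertible whenever Q₁(x) ≠ 0 and Q₂(x) ≠ 0. -/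

import Mathlib

/-- The determinant of the matrix of left multiplication by a quaternion. -/
lemma det_quat (a b c d : ℝ) :
    (!![a, -b, -c, -d; b, a, -d, c; c, d, a, -b; d, -c, b, a] : Matrix (Fin 4) (Fin 4) ℝ).det
      = (a^2 + b^2 + c^2 + d^2)^2 := by
  simp [Matrix.det_succ_row_zero, Fin.sum_univ_succ, Fin.succAbove]
  ring

/-- Pairing of the indices `i` and `7 - i`. -/
def pairEquiv : Fin 4 ⊕ Fin 4 ≃ Fin 8 where
  toFun := Sum.elim ![0, 1, 2, 3] ![7, 6, 5, 4]
  invFun := ![.inl 0, .inl 1, .inl 2, .inl 3, .inr 3, .inr 2, .inr 1, .inr 0]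
  left_inv := by decide
  right_inv := by decide

/-- The determinant of the left-multiplication matrix `Mₓ` of an octonion-like number
equals `Q₁(x)²·Q₂(x)²`; in particular `Mₓ` is invertible whenever `Q₁(x) ≠ 0` and
`Q₂(x) ≠ 0`. -/
theorem det_leftMul_matrix_eq_seminorms_sq
    (x₀ x₁ x₂ x₃ x₄ x₅ x₆ x₇ : ℝ) (M : Matrix (Fin 8) (Fin 8) ℝ)
    (hM : M = !![x₀, -x₁, -x₂, -x₃, -x₄, -x₅, -x₆, x₇;
        x₁, x₀, -x₃, x₂, x₅, -x₄, -x₇, -x₆;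
        x₂, x₃, x₀, -x₁, -x₆, -x₇, x₄, -x₅;
        x₃, -x₂, x₁, x₀, -x₇, x₆, -x₅, -x₄;
        x₄, -x₅, x₆, -x₇, x₀, x₁, -x₂, -x₃;
        x₅, x₄, -x₇, -x₆, -x₁, x₀, x₃, -x₂;
        x₆, -x₇, -x₄, x₅, x₂, -x₃, x₀, -x₁;
        x₇, x₆, x₅, x₄, x₃, x₂, x₁, x₀]) :
    M.det = ((x₀^2 + x₁^2 + x₂^2 + x₃^2 + x₄^2 + x₅^2 + x₆^2 + x₇^2) - 2*(x₁*x₆ + x₂*x₅ + x₃*x₄) + 2*x₀*x₇)^2 * ((x₀^2 + x₁^2 + x₂^2 + x₃^2 + x₄^2 + x₅^2 + x₆^2 + x₇^2) + 2*(x₁*x₆ + x₂*x₅ + x₃*x₄) - 2*x₀*x₇)^2 ∧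
    (((x₀^2 + x₁^2 + x₂^2 + x₃^2 + x₄^2 + x₅^2 + x₆^2 + x₇^2) - 2*(x₁*x₆ + x₂*x₅ + x₃*x₄) + 2*x₀*x₇) ≠ 0 → ((x₀^2 + x₁^2 + x₂^2 + x₃^2 + x₄^2 + x₅^2 + x₆^2 + x₇^2) + 2*(x₁*x₆ + x₂*x₅ + x₃*x₄) - 2*x₀*x₇) ≠ 0 → IsUnit M) := by
  have key : M.det = ((x₀+x₇)^2 + (x₁-x₆)^2 + (x₂-x₅)^2 + (x₃-x₄)^2)^2 *
      ((x₀-x₇)^2 + (x₁+x₆)^2 + (x₂+x₅)^2 + (x₃+x₄)^2)^2 := by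
    rw [← det_quat (x₀+x₇) (x₁-x₆) (x₂-x₅) (x₃-x₄), ← det_quat (x₀-x₇) (x₁+x₆) (x₂+x₅) (x₃+x₄)]
    set X : Matrix (Fin 4) (Fin 4) ℝ := !![x₀+x₇, -(x₁-x₆), -(x₂-x₅), -(x₃-x₄);
      x₁-x₆, x₀+x₇, -(x₃-x₄), x₂-x₅; x₂-x₅, x₃-x₄, x₀+x₇, -(x₁-x₆);
      x₃-x₄, -(x₂-x₅), x₁-x₆, x₀+x₇] with hX
    set Y : Matrix (Fin 4) (Fin 4) ℝ := !![x₀-x₇, -(x₁+x₆), -(x₂+x₅), -(x₃+x₄);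
      x₁+x₆, x₀-x₇, -(x₃+x₄), x₂+x₅; x₂+x₅, x₃+x₄, x₀-x₇, -(x₁+x₆);
      x₃+x₄, -(x₂+x₅), x₁+x₆, x₀-x₇] with hY
    let S : Matrix (Fin 4) (Fin 4) ℝ := Matrix.diagonal ![1, -1, -1, -1]
    let P : Matrix (Fin 4 ⊕ Fin 4) (Fin 4 ⊕ Fin 4) ℝ := Matrix.fromBlocks 1 1 S (-S)
    have hP : P.det ≠ 0 := by
      have h : -S - S * 1 = Matrix.diagonal ![-2, 2, 2, 2] := by
        ext i j
        fin_cases i <;> fin_cases j <;> simp [S] <;> norm_num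
      rw [Matrix.det_fromBlocks_one₁₁, h, Matrix.det_diagonal]
      simp [Fin.prod_univ_succ]
    have hMP : M.submatrix pairEquiv pairEquiv * P = P * Matrix.fromBlocks X 0 0 Y := by
      ext i j
      rcases i with i | i <;> rcases j with j | j <;> fin_cases i <;> fin_cases j <;>
        simp [Matrix.mul_apply, Fin.sum_univ_succ, P, S, hM, hX, hY, pairEquiv,
          Matrix.one_apply, Matrix.diagonal_apply] <;> ring
    have h := congrArg Matrix.det hMP
    rw [Matrix.det_mul, Matrix.det_mul, Matrix.det_fromBlocks_zero₂₁,
      Matrix.det_submatrix_equiv_self, mul_comm] at h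
    exact mul_left_cancel₀ hP h
  have hdet : M.det = ((x₀^2 + x₁^2 + x₂^2 + x₃^2 + x₄^2 + x₅^2 + x₆^2 + x₇^2) - 2*(x₁*x₆ + x₂*x₅ + x₃*x₄) + 2*x₀*x₇)^2 * ((x₀^2 + x₁^2 + x₂^2 + x₃^2 + x₄^2 + x₅^2 + x₆^2 + x₇^2) + 2*(x₁*x₆ + x₂*x₅ + x₃*x₄) - 2*x₀*x₇)^2 := key.trans (by ring)
  refine ⟨hdet, fun h1 h2 => ?_⟩
  rw [Matrix.isUnit_iff_isUnit_det, hdet]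
  exact (mul_ne_zero (pow_ne_zero 2 h1) (pow_ne_zero 2 h2)).isUnit
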